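/- Let X be a Hausdorff zero-dimensional space, let x and y be distinct points, let F be a finite subset of X not containing x or y, and suppose there exist neighborhoods U_x of x, U_y of y and a homeomorphism h : U_x → U_y with h(x) = y. Then there exists a homeomorphism g of X onto itself that fixes every point of F, with g(x) = y and g(y) = x. -/

import Mathlib

/-- In a Hausdorff zero-dimensional space, similar points can be swapped by a
global homeomorphism fixing any given finite set avoiding them. -/
theorem swap_similar_points (X : Type*) [TopologicalSpace X] [T2Space X]
    (hzd : ∀ (x : X) (U : Set X), IsOpen U → x ∈ U →
      ∃ V : Set X, IsClopen V ∧ x ∈ V ∧ V ⊆ U)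
    (x y : X) (hxy : x ≠ y) (F : Set X) (hF : F.Finite)
    (hxF : x ∉ F) (hyF : y ∉ F)
    (hsim : ∃ (U V : Set X) (_ : IsOpen U) (_ : IsOpen V) (hx : x ∈ U)
      (_ : y ∈ V) (h : U ≃ₜ V), (h ⟨x, hx⟩ : X) = y) :
    ∃ g : X ≃ₜ X, (∀ z ∈ F, g z = z) ∧ g x = y ∧ g y = x := by
  classical
  obtain ⟨U, V, hU, hV, hx, hy, h, hh⟩ := hsim
  -- total extensions of `h` and its inverse
  obtain ⟨a, ha⟩ : ∃ a : X → X, ∀ z : U, a z = h z :=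
    ⟨fun z => if hz : z ∈ U then h ⟨z, hz⟩ else z, fun z => by simp⟩
  obtain ⟨b, hb⟩ : ∃ b : X → X, ∀ z : V, b z = h.symm z :=
    ⟨fun z => if hz : z ∈ V then h.symm ⟨z, hz⟩ else z, fun z => by simp⟩
  have hac : ContinuousOn a U := by
    rw [continuousOn_iff_continuous_domRestrict]
    have : U.domRestrict a = fun z => (h z : X) := funext ha
    rw [this]
    exact continuous_subtype_val.comp h.continuous
  have hbc : ContinuousOn b V := by
    rw [continuousOn_iff_continuous_domRestrict]
    have : V.domRestrict b = fun z => (h.symm z : X) := funext hb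
    rw [this]
    exact continuous_subtype_val.comp h.symm.continuous
  have hba : ∀ z ∈ U, b (a z) = z := fun z hz => by
    rw [ha ⟨z, hz⟩, hb]; simp
  have hab : ∀ z ∈ V, a (b z) = z := fun z hz => by
    rw [hb ⟨z, hz⟩, ha]; simp
  have hax : a x = y := by rw [ha ⟨x, hx⟩, hh]
  obtain ⟨A, B, hA, hB, hxA, hyB, hAB⟩ := t2_separation hxy
  have hFo : IsOpen Fᶜ := hF.isClosed.isOpen_compl
  obtain ⟨C, hC, hyC, hCs⟩ := hzd y (B ∩ V ∩ Fᶜ) ((hB.inter hV).inter hFo) ⟨⟨hyB, hy⟩, hyF⟩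
  obtain ⟨W, hW, hxW, hWs⟩ := hzd x (A ∩ Fᶜ ∩ (U ∩ a ⁻¹' C))
    ((hA.inter hFo).inter (hac.isOpen_inter_preimage hU hC.isOpen))
    ⟨⟨hxA, hxF⟩, hx, by simpa [hax] using hyC⟩
  have hCV : C ⊆ V := fun z hz => (hCs hz).1.2
  have hWU : W ⊆ U := fun z hz => (hWs hz).2.1
  have hT1 : IsOpen (C ∩ b ⁻¹' W) := (hbc.mono hCV).isOpen_inter_preimage hC.isOpen hW.isOpen
  have hT2 : IsClosed (C ∩ b ⁻¹' W) :=
    (hbc.mono hCV).preimage_isClosed_of_isClosed hC.isClosed hW.isClosed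
  obtain ⟨T, hT⟩ : ∃ T, T = C ∩ b ⁻¹' W := ⟨_, rfl⟩
  rw [← hT] at hT1 hT2
  have hTV : T ⊆ V := fun z hz => hCV (hT ▸ hz : z ∈ C ∩ b ⁻¹' W).1
  have hTW : ∀ z ∈ T, b z ∈ W := fun z hz => (hT ▸ hz : z ∈ C ∩ b ⁻¹' W).2
  have hWT : ∀ z ∈ W, a z ∈ T := fun z hz => by
    rw [hT]
    refine ⟨(hWs hz).2.2, ?_⟩
    change b (a z) ∈ W
    rwa [hba z (hWU hz)]
  have hdisj : ∀ z ∈ T, z ∉ W := fun z hz hz' =>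
    Set.disjoint_left.1 hAB (hWs hz').1.1 (hCs (hT ▸ hz : z ∈ C ∩ b ⁻¹' W).1).1.1
  obtain ⟨g, hg⟩ : ∃ g : X → X, g = fun z => if z ∈ W then a z else if z ∈ T then b z else z :=
    ⟨_, rfl⟩
  have gW : ∀ z ∈ W, g z = a z := fun z hz => by simp [hg, hz]
  have gT : ∀ z ∈ T, g z = b z := fun z hz => by simp [hg, hz, hdisj z hz]
  have gN : ∀ z, z ∉ W → z ∉ T → g z = z := fun z h1 h2 => by simp [hg, h1, h2]
  have hinv : Function.Involutive g := by
    intro z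
    by_cases h1 : z ∈ W
    · rw [gW z h1, gT _ (hWT z h1), hba z (hWU h1)]
    by_cases h2 : z ∈ T
    · rw [gT z h2, gW _ (hTW z h2), hab z (hTV h2)]
    rw [gN z h1 h2, gN z h1 h2]
  have hcont : Continuous g := by
    rw [continuous_iff_continuousAt]
    intro z
    by_cases h1 : z ∈ W
    · exact (((hac.mono hWU).congr gW).continuousAt (hW.isOpen.mem_nhds h1))
    by_cases h2 : z ∈ T
    · exact (((hbc.mono hTV).congr gT).continuousAt (hT1.mem_nhds h2))
    have ho : IsOpen (Wᶜ ∩ Tᶜ) := hW.isClosed.isOpen_compl.inter hT2.isOpen_compl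
    have hc : ContinuousOn g (Wᶜ ∩ Tᶜ) :=
      continuousOn_id.congr fun w hw => gN w hw.1 hw.2
    exact hc.continuousAt (ho.mem_nhds ⟨h1, h2⟩)
  have hgx : g x = y := by rw [gW x hxW, hax]
  refine ⟨⟨hinv.toPerm, hcont, hcont⟩, fun z hz => ?_, hgx, ?_⟩
  · exact gN z (fun hw => (hWs hw).1.2 hz)
      (fun ht => (hCs (hT ▸ ht : z ∈ C ∩ b ⁻¹' W).1).2 hz)
  · change g y = x
    rw [← hgx, hinv x]
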